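/- Consider the intercept-only probit model: p = 1, X_i = 1 for all i, prior B ~ N(0, Q⁻¹) with fixed Q > 0 and v = 0, and a fixed sequence {Y_i}_{i=1}^∞ of binary responses; let p̂_n = n⁻¹ ∑_{i=1}^n Y_i and 𝒟_n the data set of the first n observations. Suppose 0 < liminf_{n→∞} p̂_n ≤ limsup_{n→∞} p̂_n < 1. Then for every δ ∈ ( 0 , 1 − [1 − (2/π)·( liminf_n p̂_n ∧ (1 − limsup_n p̂_n) )]² ), setting λ = [1 − (2/π)·( liminf_n p̂_n ∧ (1 − limsup_n p̂_n) )]² + δ, L = 1+λ, any d > 2L/(1−λ) and ε = 2^{−1/2} e^{−d}, and choosing r ∈ (0,1) so that ρ := max{ (1−ε)^r , ((1+2L+λd)/(1+d))^{1−r} (1+2(λd+L))^r } < 1, one has limsup_{n→∞} ρ*(𝒟_n) ≤ ρ < 1 and limsup_{n→∞} ρ**(𝒟_n) ≤ ρ < 1. -/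

import Mathlib

open MeasureTheory Filter

noncomputable section

/-- standard normal pdf -/
def nphi (x : ℝ) : ℝ := (Real.sqrt (2 * Real.pi))⁻¹ * Real.exp (-(x ^ 2) / 2)

/-- standard normal cdf -/
def nPhi (x : ℝ) : ℝ := ∫ t in Set.Iic x, nphi t

/-- density of TN(θ,1;1) (if b = true) resp. TN(θ,1;0) (if b = false) at z -/
def tn (θ : ℝ) (b : Bool) (z : ℝ) : ℝ :=
  if b then (if 0 < z then nphi (z - θ) / nPhi θ else 0)
  else (if z < 0 then nphi (z - θ) / (1 - nPhi θ) else 0)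

/-- Albert and Chib's transition density for the intercept-only model:
here Σ = n + Q and the prior mean is v = 0. -/
def kAC1 (Q : ℝ) (n : ℕ) (Yb : Fin n → Bool) (β β' : ℝ) : ℝ :=
  ∫ z : Fin n → ℝ,
    (Real.sqrt ((n : ℝ) + Q) *
        nphi (Real.sqrt ((n : ℝ) + Q) * (β' - (∑ i, z i) / ((n : ℝ) + Q)))) *
      ∏ i, tn β (Yb i) (z i)

/-- `kIter k m` is the (m+1)-step transition density associated with a transition
density `k`. -/
def kIter {A : Type*} [MeasureSpace A] (k : A → A → ℝ) : ℕ → A → A → ℝ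
  | 0 => k
  | m + 1 => fun x y => ∫ z, kIter k m x z * k z y

/-- the posterior density for the intercept-only model -/
def post1 (Q : ℝ) (n : ℕ) (Yb : Fin n → Bool) (β : ℝ) : ℝ :=
  ((∏ i, if Yb i then nPhi β else 1 - nPhi β) * Real.exp (-(Q * β ^ 2) / 2)) /
    ∫ β', (∏ i, if Yb i then nPhi β' else 1 - nPhi β') * Real.exp (-(Q * β' ^ 2) / 2)

/-- the geometric convergence rate of a chain on ℝ with transition density k and
stationary density pi -/
def rhoStar1 (k : ℝ → ℝ → ℝ) (pi : ℝ → ℝ) : ℝ :=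
  sInf {ρ : ℝ | ρ ∈ Set.Icc (0 : ℝ) 1 ∧ ∃ M : ℝ → ℝ, (∀ β, 0 ≤ M β) ∧
    ∀ (β : ℝ) (m : ℕ), (∫ β', |kIter k m β β' - pi β'|) ≤ M β * ρ ^ (m + 1)}

/-- the L²-geometric convergence rate of a chain on ℝ with transition density k and
stationary density pi -/
def rhoSS1 (k : ℝ → ℝ → ℝ) (pi : ℝ → ℝ) : ℝ :=
  sInf {ρ : ℝ | ρ ∈ Set.Icc (0 : ℝ) 1 ∧ ∀ ν : ℝ → ℝ,
    (∀ β, 0 ≤ ν β) → (∫ β, ν β) = 1 → Integrable (fun β => ν β ^ 2 / pi β) →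
    ∃ Mν : ℝ, ∀ m : ℕ,
      (∫ β', |(∫ β, kIter k m β β' * ν β) - pi β'|) ≤ Mν * ρ ^ (m + 1)}

/-- the proportion of successes among the first n responses -/
def phat (Ys : ℕ → Bool) (n : ℕ) : ℝ :=
  (∑ i ∈ Finset.range n, if Ys i then (1 : ℝ) else 0) / n


theorem nphi_eq (x : ℝ) : nphi x = ProbabilityTheory.gaussianPDFReal 0 1 x := by
  simp [nphi, ProbabilityTheory.gaussianPDFReal]

theorem nphi_pos (x : ℝ) : 0 < nphi x := by
  unfold nphi; positivity

theorem nphi_cont : Continuous nphi := by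
  unfold nphi; fun_prop

theorem nphi_int : Integrable nphi := by
  have : nphi = ProbabilityTheory.gaussianPDFReal 0 1 := funext nphi_eq
  rw [this]; exact ProbabilityTheory.integrable_gaussianPDFReal 0 1

theorem nphi_int1 : ∫ x, nphi x = 1 := by
  have : nphi = ProbabilityTheory.gaussianPDFReal 0 1 := funext nphi_eq
  rw [this]; exact ProbabilityTheory.integral_gaussianPDFReal_eq_one 0 one_ne_zero

theorem nphi_neg (x : ℝ) : nphi (-x) = nphi x := by simp [nphi]

theorem nphi_deriv (x : ℝ) : HasDerivAt nphi (-x * nphi x) x := by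
  unfold nphi
  have h : HasDerivAt (fun x : ℝ => -(x^2)/2) (-x) x := by
    have := ((hasDerivAt_pow 2 x).neg.div_const 2)
    refine this.congr_deriv ?_
    simp; ring
  have := (h.exp).const_mul ((Real.sqrt (2 * Real.pi))⁻¹)
  refine this.congr_deriv ?_
  ring

theorem nphi_mom_int : Integrable (fun x => x * nphi x) := by
  have := integrable_mul_exp_neg_mul_sq (b := 1/2) (by norm_num)
  have := this.const_mul ((Real.sqrt (2 * Real.pi))⁻¹)
  refine this.congr (ae_of_all _ fun x => ?_)
  simp only [nphi]
  rw [show -(x^2)/2 = -(1/2) * x^2 by ring]; ring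

theorem nphi_tendsto_bot : Tendsto nphi atBot (nhds 0) := by
  have h2 : Tendsto (fun x : ℝ => -(x^2)/2) atBot atBot := by
    have : Tendsto (fun x : ℝ => x^2) atBot atTop := by
      have h := (tendsto_pow_atTop (α := ℝ) (n := 2) (by norm_num)).comp tendsto_neg_atBot_atTop
      refine h.congr fun x => ?_
      simp
    have h3 := tendsto_neg_atTop_atBot.comp this
    exact h3.atBot_div_const (by norm_num)
  have := (Real.tendsto_exp_atBot.comp h2).const_mul ((Real.sqrt (2 * Real.pi))⁻¹)
  rw [mul_zero] at this
  exact this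

theorem nphi_tendsto_top : Tendsto nphi atTop (nhds 0) := by
  have := nphi_tendsto_bot.comp tendsto_neg_atTop_atBot
  refine this.congr fun x => ?_
  simp [nphi_neg]

theorem nPhi_pos (x : ℝ) : 0 < nPhi x := by
  unfold nPhi
  rw [setIntegral_pos_iff_support_of_nonneg_ae]
  · have : Function.support nphi = Set.univ := by
      ext t; simp [(nphi_pos t).ne']
    rw [this]; simp
  · exact ae_of_all _ fun t => (nphi_pos t).le
  · exact nphi_int.integrableOn

theorem nPhi_compl (x : ℝ) : 1 - nPhi x = nPhi (-x) := by
  have h1 : (∫ t in Set.Iic x, nphi t) + ∫ t in Set.Ioi x, nphi t = 1 := by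
    rw [← nphi_int1]
    have := integral_add_compl (s := Set.Iic x) measurableSet_Iic nphi_int
    simpa using this
  have h2 : ∫ t in Set.Iic (-x), nphi (t) = ∫ t in Set.Ioi x, nphi t := by
    rw [← integral_comp_neg_Ioi (f := nphi)]
    simp [nphi_neg]
  unfold nPhi
  rw [h2]; linarith

theorem nPhi_lt_one (x : ℝ) : nPhi x < 1 := by
  have := nPhi_pos (-x)
  rw [← nPhi_compl] at this; linarith

theorem nPhi_deriv (x : ℝ) : HasDerivAt nPhi (nphi x) x := by
  have h0 : nPhi = fun x => nPhi 0 + ∫ t in (0:ℝ)..x, nphi t := by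
    ext x
    unfold nPhi
    rw [← intervalIntegral.integral_Iic_sub_Iic nphi_int.integrableOn nphi_int.integrableOn]
    ring
  rw [h0]
  exact (intervalIntegral.integral_hasDerivAt_right (nphi_int.intervalIntegrable)
    nphi_cont.stronglyMeasurable.stronglyMeasurableAtFilter nphi_cont.continuousAt).const_add _

theorem nPhi_cont : Continuous nPhi :=
  continuous_iff_continuousAt.2 fun x => (nPhi_deriv x).continuousAt

theorem nPhi_tendsto_bot : Tendsto nPhi atBot (nhds 0) := by
  have := tendsto_setIntegral_of_antitone (μ := volume) (f := nphi) (s := fun x : ℝ => Set.Iic (-x))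
    (fun i => measurableSet_Iic) (fun a b hab => Set.Iic_subset_Iic.2 (neg_le_neg hab))
    ⟨0, nphi_int.integrableOn⟩
  have he : (⋂ n : ℝ, Set.Iic (-n)) = (∅ : Set ℝ) := by
    ext y; simp only [Set.mem_iInter, Set.mem_Iic, Set.mem_empty_iff_false, iff_false]
    intro h; have := h (-y + 1); linarith
  rw [he] at this
  simp only [Measure.restrict_empty, integral_zero_measure] at this
  have h2 := this.comp tendsto_neg_atBot_atTop
  refine h2.congr fun x => ?_
  simp [nPhi]

/-- the tail moment: `∫_{t ≤ x} t φ(t) dt = - φ(x)`. -/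
theorem nphi_tail_mom (x : ℝ) : ∫ t in Set.Iic x, t * nphi t = - nphi x := by
  have := integral_Iic_of_hasDerivAt_of_tendsto' (a := x) (f := fun t => - nphi t)
    (f' := fun t => t * nphi t) (m := 0)
    (fun t _ => by have := (nphi_deriv t).neg; exact this.congr_deriv (by ring))
    nphi_mom_int.integrableOn (by simpa using nphi_tendsto_bot.neg)
  simpa using this

theorem mills_nonneg (x : ℝ) : 0 ≤ nphi x + x * nPhi x := by
  have h1 : ∫ t in Set.Iic x, t * nphi t ≤ ∫ t in Set.Iic x, x * nphi t := by
    refine setIntegral_mono_on nphi_mom_int.integrableOn (nphi_int.const_mul x).integrableOn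
      measurableSet_Iic fun t ht => ?_
    exact mul_le_mul_of_nonneg_right ht (nphi_pos t).le
  rw [nphi_tail_mom, integral_const_mul] at h1
  unfold nPhi; linarith

theorem mills_deriv (x : ℝ) : HasDerivAt (fun x => nphi x + x * nPhi x) (nPhi x) x := by
  have := (nphi_deriv x).add ((hasDerivAt_id x).mul (nPhi_deriv x))
  refine this.congr_deriv ?_
  simp

theorem mills_half {x : ℝ} (hx : x ≤ 0) : nPhi x ^ 2 / 2 ≤ nphi x * (nphi x + x * nPhi x) := by
  set F : ℝ → ℝ := fun x => nphi x * (nphi x + x * nPhi x) - nPhi x ^ 2 / 2 with hF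
  have hd : ∀ y, HasDerivAt F (-y * nphi y * (nphi y + y * nPhi y)) y := by
    intro y
    have := ((nphi_deriv y).mul (mills_deriv y)).sub (((nPhi_deriv y).pow 2).div_const 2)
    refine this.congr_deriv ?_
    simp; ring
  have hmono : MonotoneOn F (Set.Iic 0) := by
    apply monotoneOn_of_hasDerivWithinAt_nonneg (convex_Iic 0)
      (fun y _ => (hd y).continuousAt.continuousWithinAt)
      (fun y _ => (hd y).hasDerivWithinAt)
    intro y hy
    have hy : y < 0 := by simpa using hy
    have := mills_nonneg y
    have := nphi_pos y
    have : 0 < -y := by linarith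
    positivity
  have hlim : Tendsto F atBot (nhds 0) := by
    have hm : Tendsto (fun x => nphi x + x * nPhi x) atBot (nhds 0) := by
      refine tendsto_of_tendsto_of_tendsto_of_le_of_le' tendsto_const_nhds nphi_tendsto_bot
        (Eventually.of_forall mills_nonneg) ?_
      filter_upwards [eventually_le_atBot 0] with y hy
      have := nPhi_pos y
      nlinarith
    have := (nphi_tendsto_bot.mul hm).sub ((nPhi_tendsto_bot.pow 2).div_const 2)
    simpa [hF] using this
  have : 0 ≤ F x := by
    refine le_of_tendsto hlim ?_
    filter_upwards [eventually_le_atBot x] with y hy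
    exact hmono (hy.trans hx) hx hy
  simp only [hF] at this; linarith

/-- mean of the truncated normal (positive side) -/
def tmean (x : ℝ) : ℝ := x + nphi x / nPhi x

theorem tmean_deriv (x : ℝ) :
    HasDerivAt tmean (1 - nphi x * (nphi x + x * nPhi x) / nPhi x ^ 2) x := by
  have hp := (nPhi_pos x).ne'
  have := (hasDerivAt_id x).add ((nphi_deriv x).div (nPhi_deriv x) hp)
  refine this.congr_deriv ?_
  field_simp
  ring

theorem tmean_one {x y : ℝ} (h : x ≤ y) : tmean y - tmean x ≤ y - x := by
  have : Antitone fun x => tmean x - x := by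
    apply antitone_of_hasDerivAt_nonpos (fun x => (tmean_deriv x).sub (hasDerivAt_id x))
    intro x
    have := mills_nonneg x
    have := nphi_pos x
    have : 0 ≤ nphi x * (nphi x + x * nPhi x) / nPhi x ^ 2 := by positivity
    simp only [Pi.zero_apply]
    linarith
  have := this h
  simp only at this
  linarith

theorem tmean_half {x y : ℝ} (h : x ≤ y) (hy : y ≤ 0) :
    tmean y - tmean x ≤ (1/2) * (y - x) := by
  have : AntitoneOn (fun x => tmean x - (1/2) * x) (Set.Iic 0) := by
    have hd : ∀ x, HasDerivAt (fun x => tmean x - (1/2) * x)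
      ((1 - nphi x * (nphi x + x * nPhi x) / nPhi x ^ 2) - (1/2) * 1) x := fun x =>
      (tmean_deriv x).sub ((hasDerivAt_id x).const_mul (1/2))
    apply antitoneOn_of_hasDerivWithinAt_nonpos (convex_Iic 0)
      (fun y _ => (hd y).continuousAt.continuousWithinAt)
      (fun y _ => (hd y).hasDerivWithinAt)
    intro z hz
    have hz : z < 0 := by simpa using hz
    have h1 := mills_half hz.le
    have h2 := nPhi_pos z
    have : 1/2 ≤ nphi z * (nphi z + z * nPhi z) / nPhi z ^ 2 := by
      rw [le_div_iff₀ (by positivity)]; linarith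
    linarith
  have := this (h.trans hy : x ∈ Set.Iic 0) hy h
  simp only at this
  linarith


theorem refl_integral (g : ℝ → ℝ) (θ : ℝ) :
    ∫ z in Set.Ioi (0:ℝ), g (θ - z) = ∫ t in Set.Iic θ, g t := by
  rw [integral_Iic_eq_integral_Iio, ← integral_indicator measurableSet_Ioi,
    ← integral_indicator measurableSet_Iio,
    ← integral_sub_left_eq_self (fun t => (Set.Iio θ).indicator g t) volume θ]
  congr 1
  ext z
  simp only [Set.indicator, Set.mem_Ioi, Set.mem_Iio]
  by_cases h : 0 < z
  · rw [if_pos h, if_pos (by linarith)]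
  · rw [if_neg h, if_neg (by linarith)]

theorem tn_true (θ : ℝ) :
    tn θ true = (Set.Ioi (0:ℝ)).indicator (fun z => nphi (θ - z) / nPhi θ) := by
  ext z
  simp only [tn, Set.indicator, Set.mem_Ioi, if_true]
  rw [← nphi_neg (z - θ)]; simp

theorem tn_false (θ z : ℝ) : tn θ false z = tn (-θ) true (-z) := by
  simp only [tn, if_true, Bool.false_eq_true, if_false]
  rw [nPhi_compl, ← nphi_neg (z - θ)]
  simp [add_comm, sub_eq_add_neg]

theorem tn_nonneg (θ : ℝ) (b : Bool) (z : ℝ) : 0 ≤ tn θ b z := by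
  have h1 := nPhi_pos θ
  have h2 := nPhi_lt_one θ
  have h3 := nphi_pos (z - θ)
  have h4 : 0 < 1 - nPhi θ := by linarith
  unfold tn
  split_ifs <;> positivity

theorem tn_meas (b : Bool) : Measurable fun p : ℝ × ℝ => tn p.1 b p.2 := by
  have h1 := nPhi_cont.measurable
  have h2 := nphi_cont.measurable
  cases b
  · simp only [tn, Bool.false_eq_true, if_false]
    refine Measurable.ite (measurableSet_lt measurable_snd measurable_const) ?_ measurable_const
    fun_prop
  · simp only [tn, if_true]
    refine Measurable.ite (measurableSet_lt measurable_const measurable_snd) ?_ measurable_const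
    fun_prop

def bmean (θ : ℝ) (b : Bool) : ℝ := if b then tmean θ else - tmean (-θ)

theorem tn_int (θ : ℝ) (b : Bool) : Integrable (tn θ b) := by
  have h : ∀ θ, Integrable (tn θ true) := by
    intro θ
    rw [tn_true]
    exact ((nphi_int.comp_sub_left θ).div_const _).indicator measurableSet_Ioi
  cases b
  · have : tn θ false = fun z => tn (-θ) true (-z) := funext (tn_false θ)
    rw [this]; exact (h (-θ)).comp_neg
  · exact h θ

theorem tn_int_one (θ : ℝ) (b : Bool) : ∫ z, tn θ b z = 1 := by
  have h : ∀ θ, ∫ z, tn θ true z = 1 := by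
    intro θ
    rw [tn_true, integral_indicator measurableSet_Ioi, integral_div, refl_integral nphi]
    exact div_self (nPhi_pos θ).ne'
  cases b
  · simp_rw [tn_false]
    rw [integral_neg_eq_self (fun z => tn (-θ) true z)]; exact h _
  · exact h θ

theorem tn_mom_int (θ : ℝ) (b : Bool) : Integrable (fun z => z * tn θ b z) := by
  have h : ∀ θ, Integrable (fun z => z * tn θ true z) := by
    intro θ
    rw [tn_true]
    have h1 : Integrable (fun t => (θ - t) * nphi t) := by
      refine ((nphi_int.const_mul θ).sub nphi_mom_int).congr (ae_of_all _ fun x => ?_)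
      simp only [Pi.sub_apply]; ring
    have h2 := ((h1.comp_sub_left θ).div_const (nPhi θ)).indicator
      (measurableSet_Ioi (a := (0:ℝ)))
    refine h2.congr (ae_of_all _ fun z => ?_)
    simp only [Set.indicator]
    split_ifs <;> ring
  cases b
  · have := (h (-θ)).comp_neg.neg
    refine this.congr (ae_of_all _ fun z => ?_)
    simp [tn_false]
  · exact h θ

theorem tn_mean (θ : ℝ) (b : Bool) : ∫ z, z * tn θ b z = bmean θ b := by
  have h : ∀ θ, ∫ z, z * tn θ true z = tmean θ := by
    intro θ
    have e : (fun z => z * tn θ true z) = (Set.Ioi (0:ℝ)).indicator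
        (fun z => (fun t => (θ - t) * nphi t) (θ - z) / nPhi θ) := by
      rw [tn_true]; ext z
      simp only [Set.indicator]
      split_ifs <;> ring
    rw [e, integral_indicator measurableSet_Ioi, integral_div,
      refl_integral (fun t => (θ - t) * nphi t)]
    have : ∫ t in Set.Iic θ, (θ - t) * nphi t = θ * nPhi θ + nphi θ := by
      simp_rw [sub_mul]
      rw [integral_sub (nphi_int.const_mul θ).integrableOn nphi_mom_int.integrableOn,
        nphi_tail_mom, integral_const_mul]
      simp [nPhi]
    rw [this, tmean]
    have := (nPhi_pos θ).ne'
    field_simp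
  cases b
  · simp_rw [tn_false]
    have := integral_neg_eq_self (fun z => (-z) * tn (-θ) true z) volume
    simp only [neg_neg] at this
    rw [this]
    simp_rw [neg_mul]
    rw [integral_neg, h]; simp [bmean]
  · simpa [bmean] using h θ

theorem bmean_neg_side (b : Bool) {x y : ℝ} (h : x ≤ y) (hy : y ≤ 0) :
    bmean y b - bmean x b ≤ (if b then 1/2 else 1) * (y - x) := by
  cases b
  · have := tmean_one (neg_le_neg h)
    simp [bmean]; linarith
  · have := tmean_half h hy
    simpa [bmean] using this

theorem bmean_pos_side (b : Bool) {x y : ℝ} (h : x ≤ y) (hx : 0 ≤ x) :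
    bmean y b - bmean x b ≤ (if b then 1 else 1/2) * (y - x) := by
  cases b
  · have := tmean_half (neg_le_neg h) (by linarith)
    simp [bmean] at *; linarith
  · have := tmean_one h
    simpa [bmean] using this

/-- the normalising constants and base density of the exponential family -/
def tnA (θ : ℝ) (b : Bool) : ℝ := Real.exp (-(θ^2)/2) / (if b then nPhi θ else 1 - nPhi θ)
def tnG (b : Bool) (z : ℝ) : ℝ := if b then (if 0 < z then nphi z else 0) else (if z < 0 then nphi z else 0)

theorem tnN_pos (θ : ℝ) (b : Bool) : 0 < (if b then nPhi θ else 1 - nPhi θ) := by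
  have h1 := nPhi_pos θ
  have h2 := nPhi_lt_one θ
  split_ifs <;> linarith

theorem tnA_pos (θ : ℝ) (b : Bool) : 0 < tnA θ b := by
  have := tnN_pos θ b
  unfold tnA; positivity

theorem tnG_nonneg (b : Bool) (z : ℝ) : 0 ≤ tnG b z := by
  have := (nphi_pos z).le
  unfold tnG; split_ifs <;> simp [this]

theorem nphi_shift (z θ : ℝ) :
    nphi (z - θ) = Real.exp (-(θ^2)/2) * (nphi z * Real.exp (θ * z)) := by
  unfold nphi
  have : Real.exp (-(z-θ)^2/2) = Real.exp (-(θ^2)/2) * Real.exp (-(z^2)/2) * Real.exp (θ * z) := by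
    rw [← Real.exp_add, ← Real.exp_add]; congr 1; ring
  rw [this]; ring

theorem tn_factor (θ : ℝ) (b : Bool) (z : ℝ) :
    tn θ b z = tnA θ b * (tnG b z * Real.exp (θ * z)) := by
  unfold tn tnA tnG
  rw [nphi_shift]
  split_ifs <;> ring

/-- association lemma -/
theorem assoc_le {α : Type*} [MeasurableSpace α] (μ : Measure α) [SigmaFinite μ]
    (u w w' : α → ℝ) (hw : Integrable w μ) (hw' : Integrable w' μ)
    (huw : Integrable (fun z => u z * w z) μ) (huw' : Integrable (fun z => u z * w' z) μ)
    (h1 : ∫ z, w z ∂μ = 1) (h1' : ∫ z, w' z ∂μ = 1)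
    (hpt : ∀ z t, 0 ≤ (u z - u t) * (w' z * w t - w' t * w z)) :
    ∫ z, u z * w z ∂μ ≤ ∫ z, u z * w' z ∂μ := by
  have a1 := huw'.mul_prod (ν := μ) hw
  have a2 := hw.mul_prod (ν := μ) huw'
  have a3 := huw.mul_prod (ν := μ) hw'
  have a4 := hw'.mul_prod (ν := μ) huw
  have e1 := integral_prod_mul (μ := μ) (ν := μ) (fun z => u z * w' z) w
  have e2 := integral_prod_mul (μ := μ) (ν := μ) w (fun z => u z * w' z)
  have e3 := integral_prod_mul (μ := μ) (ν := μ) (fun z => u z * w z) w'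
  have e4 := integral_prod_mul (μ := μ) (ν := μ) w' (fun z => u z * w z)
  have key : 0 ≤ ∫ p : α × α, ((u p.1 * w' p.1) * w p.2 + w p.1 * (u p.2 * w' p.2))
      - ((u p.1 * w p.1) * w' p.2 + w' p.1 * (u p.2 * w p.2)) ∂(μ.prod μ) := by
    apply integral_nonneg
    intro p
    have := hpt p.1 p.2
    simp only [Pi.zero_apply]
    linarith
  replace key := key.trans_eq (integral_sub (a1.add a2) (a3.add a4))
  rw [integral_add a1 a2, integral_add a3 a4, e1, e2, e3, e4, h1, h1'] at key
  linarith


/-- joint density of the latent variables -/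
def Wd {n : ℕ} (Yb : Fin n → Bool) (β : ℝ) (z : Fin n → ℝ) : ℝ := ∏ i, tn β (Yb i) (z i)

section W
variable {n : ℕ} (Yb : Fin n → Bool)

theorem Wd_nonneg (β : ℝ) (z : Fin n → ℝ) : 0 ≤ Wd Yb β z :=
  Finset.prod_nonneg fun i _ => tn_nonneg _ _ _

theorem Wd_meas : Measurable fun p : ℝ × (Fin n → ℝ) => Wd Yb p.1 p.2 := by
  unfold Wd
  refine Finset.measurable_prod _ fun i _ => ?_
  exact (tn_meas (Yb i)).comp (measurable_fst.prodMk ((measurable_pi_apply i).comp measurable_snd))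

theorem Wd_int (β : ℝ) : Integrable (Wd Yb β) :=
  Integrable.fintype_prod (f := fun i => tn β (Yb i)) fun i => tn_int β (Yb i)

theorem Wd_one (β : ℝ) : ∫ z, Wd Yb β z = 1 := by
  unfold Wd
  rw [integral_fintype_prod_volume_eq_prod (fun i => tn β (Yb i))]
  simp [tn_int_one]

theorem Wd_coord_eq (β : ℝ) (i : Fin n) (z : Fin n → ℝ) : z i * Wd Yb β z =
    ∏ j, (fun x => (if j = i then x else 1) * tn β (Yb j) x) (z j) := by
  simp only [Wd]
  rw [Finset.prod_mul_distrib]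
  simp

theorem Wd_coord_int (β : ℝ) (i : Fin n) : Integrable (fun z : Fin n → ℝ => z i * Wd Yb β z) := by
  simp_rw [Wd_coord_eq]
  refine Integrable.fintype_prod (f := fun j x => (if j = i then x else 1) * tn β (Yb j) x) ?_
  intro j
  by_cases h : j = i
  · simp only [h, if_true]; exact tn_mom_int β (Yb i)
  · simp only [h, if_false, one_mul]; exact tn_int β (Yb j)

theorem Wd_coord_mean (β : ℝ) (i : Fin n) :
    ∫ z : Fin n → ℝ, z i * Wd Yb β z = bmean β (Yb i) := by
  simp_rw [Wd_coord_eq]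
  rw [integral_fintype_prod_volume_eq_prod
    (fun j x => (if j = i then x else 1) * tn β (Yb j) x), Finset.prod_eq_single i]
  · simp [tn_mean]
  · intro j _ h
    simp [h, tn_int_one]
  · simp

theorem Wd_sum_int (β : ℝ) : Integrable (fun z : Fin n → ℝ => (∑ i, z i) * Wd Yb β z) := by
  simp_rw [Finset.sum_mul]
  exact integrable_finsetSum _ fun i _ => Wd_coord_int Yb β i

theorem Wd_sum_mean (β : ℝ) :
    ∫ z : Fin n → ℝ, (∑ i, z i) * Wd Yb β z = ∑ i, bmean β (Yb i) := by
  simp_rw [Finset.sum_mul]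
  rw [integral_finsetSum _ fun i _ => Wd_coord_int Yb β i]
  simp [Wd_coord_mean]

theorem Wd_factor (β : ℝ) (z : Fin n → ℝ) : Wd Yb β z =
    (∏ i, tnA β (Yb i)) * ((∏ i, tnG (Yb i) (z i)) * Real.exp (β * ∑ i, z i)) := by
  unfold Wd
  simp_rw [tn_factor]
  rw [Finset.prod_mul_distrib, Finset.prod_mul_distrib, ← Real.exp_sum, Finset.mul_sum]

theorem Wd_cross {x y : ℝ} (hxy : x ≤ y) (z t : Fin n → ℝ) (a : ℝ)
    (ha : 0 ≤ a * (∑ i, z i - ∑ i, t i)) :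
    0 ≤ a * (Wd Yb y z * Wd Yb x t - Wd Yb y t * Wd Yb x z) := by
  simp_rw [Wd_factor]
  set S := ∑ i, z i
  set T := ∑ i, t i
  have p1 : 0 < ∏ i, tnA x (Yb i) := Finset.prod_pos fun i _ => tnA_pos _ _
  have p2 : 0 < ∏ i, tnA y (Yb i) := Finset.prod_pos fun i _ => tnA_pos _ _
  have p3 : 0 ≤ ∏ i, tnG (Yb i) (z i) := Finset.prod_nonneg fun i _ => tnG_nonneg _ _
  have p4 : 0 ≤ ∏ i, tnG (Yb i) (t i) := Finset.prod_nonneg fun i _ => tnG_nonneg _ _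
  have e : a * ((∏ i, tnA y (Yb i)) * ((∏ i, tnG (Yb i) (z i)) * Real.exp (y * S)) *
      ((∏ i, tnA x (Yb i)) * ((∏ i, tnG (Yb i) (t i)) * Real.exp (x * T))) -
      (∏ i, tnA y (Yb i)) * ((∏ i, tnG (Yb i) (t i)) * Real.exp (y * T)) *
      ((∏ i, tnA x (Yb i)) * ((∏ i, tnG (Yb i) (z i)) * Real.exp (x * S)))) =
      ((∏ i, tnA x (Yb i)) * (∏ i, tnA y (Yb i)) * (∏ i, tnG (Yb i) (z i)) *
      (∏ i, tnG (Yb i) (t i))) * (a * (Real.exp (y * S + x * T) - Real.exp (y * T + x * S))) := by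
    rw [Real.exp_add, Real.exp_add]; ring
  rw [e]
  refine mul_nonneg (by positivity) ?_
  rcases lt_trichotomy S T with h | h | h
  · have h1 : a ≤ 0 := by
      by_contra hc
      push Not at hc
      have : a * (S - T) < 0 := mul_neg_of_pos_of_neg hc (by linarith)
      linarith
    have h2 : Real.exp (y * S + x * T) ≤ Real.exp (y * T + x * S) :=
      Real.exp_le_exp.2 (by nlinarith)
    exact mul_nonneg_of_nonpos_of_nonpos h1 (by linarith)
  · rw [h]; simp
  · have h1 : 0 ≤ a := by
      by_contra hc
      push Not at hc
      have : a * (S - T) < 0 := mul_neg_of_neg_of_pos hc (by linarith)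
      linarith
    have h2 : Real.exp (y * T + x * S) ≤ Real.exp (y * S + x * T) :=
      Real.exp_le_exp.2 (by nlinarith)
    exact mul_nonneg h1 (by linarith)

theorem Wd_bdd_int (β : ℝ) (h : ℝ → ℝ) (hm : Measurable h) (hb : ∀ s, |h s| ≤ 1) :
    Integrable (fun z : Fin n → ℝ => h (∑ i, z i) * Wd Yb β z) := by
  refine (Wd_int Yb β).bdd_mul (c := 1) ?_ ?_
  · exact (hm.comp (by fun_prop)).aestronglyMeasurable
  · exact ae_of_all _ fun z => hb _

theorem Wd_lip (h : ℝ → ℝ) (hm : Measurable h) (hb : ∀ s, |h s| ≤ 1) (K : ℝ)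
    (hK : ∀ s t, |h s - h t| ≤ K * |s - t|) {x y : ℝ} (hxy : x ≤ y) :
    |(∫ z : Fin n → ℝ, h (∑ i, z i) * Wd Yb y z) - ∫ z : Fin n → ℝ, h (∑ i, z i) * Wd Yb x z|
      ≤ K * (∑ i, bmean y (Yb i) - ∑ i, bmean x (Yb i)) := by
  have main : ∀ σ : ℝ, (σ = 1 ∨ σ = -1) →
      K * (∑ i, bmean x (Yb i)) + σ * (∫ z : Fin n → ℝ, h (∑ i, z i) * Wd Yb x z) ≤
      K * (∑ i, bmean y (Yb i)) + σ * (∫ z : Fin n → ℝ, h (∑ i, z i) * Wd Yb y z) := by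
    intro σ hσ
    have ii : ∀ β, Integrable (fun z : Fin n → ℝ =>
        K * ((∑ i, z i) * Wd Yb β z) + σ * (h (∑ i, z i) * Wd Yb β z)) := fun β =>
      ((Wd_sum_int Yb β).const_mul K).add ((Wd_bdd_int Yb β h hm hb).const_mul σ)
    have ee : ∀ β, ∫ z : Fin n → ℝ,
        (K * (∑ i, z i) + σ * h (∑ i, z i)) * Wd Yb β z =
        K * (∑ i, bmean β (Yb i)) + σ * (∫ z : Fin n → ℝ, h (∑ i, z i) * Wd Yb β z) := by
      intro β
      rw [← Wd_sum_mean, ← integral_const_mul, ← integral_const_mul, ← integral_add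
        ((Wd_sum_int Yb β).const_mul K) ((Wd_bdd_int Yb β h hm hb).const_mul σ)]
      congr 1; ext z; ring
    rw [← ee, ← ee]
    have ii' : ∀ β, Integrable (fun z : Fin n → ℝ =>
        (K * (∑ i, z i) + σ * h (∑ i, z i)) * Wd Yb β z) := fun β =>
      (ii β).congr (ae_of_all _ fun z => by ring)
    refine assoc_le volume (fun z : Fin n → ℝ => K * (∑ i, z i) + σ * h (∑ i, z i)) _ _
      (Wd_int Yb x) (Wd_int Yb y) (ii' x) (ii' y) (Wd_one Yb x) (Wd_one Yb y) ?_
    intro z t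
    apply Wd_cross Yb hxy
    set S := ∑ i, z i
    set T := ∑ i, t i
    have h1 := abs_le.1 (hK S T)
    have h2 : |σ * (h S - h T)| ≤ K * |S - T| := by
      rcases hσ with rfl | rfl <;> simpa [abs_sub_comm] using hK S T
    have h3 := abs_le.1 h2
    rcases le_total S T with hh | hh
    · rw [abs_of_nonpos (by linarith)] at h3
      have : K * S + σ * h S - (K * T + σ * h T) ≤ 0 := by nlinarith
      exact mul_nonneg_of_nonpos_of_nonpos this (by linarith)
    · rw [abs_of_nonneg (by linarith)] at h3
      have : 0 ≤ K * S + σ * h S - (K * T + σ * h T) := by nlinarith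
      exact mul_nonneg this (by linarith)
  have m1 := main 1 (Or.inl rfl)
  have m2 := main (-1) (Or.inr rfl)
  rw [abs_le]
  constructor <;> linarith

end W

/-- Gaussian density with precision `s`. -/
def qd (s y : ℝ) : ℝ := Real.sqrt s * nphi (Real.sqrt s * y)

theorem qd_nonneg (s y : ℝ) : 0 ≤ qd s y := by
  have := nphi_pos (Real.sqrt s * y)
  unfold qd; positivity

theorem qd_cont (s : ℝ) : Continuous (qd s) := by
  have := nphi_cont
  unfold qd; fun_prop

theorem qd_int {s : ℝ} (hs : 0 < s) : Integrable (qd s) := by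
  unfold qd
  exact (nphi_int.comp_mul_left' (Real.sqrt_pos.2 hs).ne').const_mul _

theorem qd_one {s : ℝ} (hs : 0 < s) : ∫ y, qd s y = 1 := by
  have h := Real.sqrt_pos.2 hs
  unfold qd
  rw [integral_const_mul, Measure.integral_comp_mul_left, nphi_int1, abs_of_pos (by positivity)]
  simp [h.ne']

theorem qd_mom_int {s : ℝ} (hs : 0 < s) : Integrable (fun y => |y| * qd s y) := by
  have h := Real.sqrt_pos.2 hs
  have := (nphi_mom_int.comp_mul_left' h.ne').abs
  refine this.congr (ae_of_all _ fun y => ?_)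
  simp only [qd, abs_mul, abs_of_pos h, abs_of_pos (nphi_pos _)]; ring

theorem qd_exp {s : ℝ} (hs : 0 < s) (y : ℝ) :
    qd s y = (Real.sqrt s * (Real.sqrt (2 * Real.pi))⁻¹) * Real.exp (-(s * y^2)/2) := by
  unfold qd nphi
  rw [mul_pow, Real.sq_sqrt hs.le]; ring

theorem exp_diff (u v : ℝ) : |Real.exp u - Real.exp v| ≤ |u - v| * (Real.exp u + Real.exp v) := by
  wlog h : v ≤ u generalizing u v
  · have := this v u (by linarith)
    rw [abs_sub_comm, abs_sub_comm u v, add_comm]; exact this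
  have h1 : Real.exp v ≤ Real.exp u := Real.exp_le_exp.2 h
  rw [abs_of_nonneg (by linarith), abs_of_nonneg (by linarith)]
  have h2 : 1 - (u - v) ≤ Real.exp (-(u - v)) := by
    have := Real.add_one_le_exp (-(u-v)); linarith
  have h3 : Real.exp v = Real.exp u * Real.exp (-(u-v)) := by
    rw [← Real.exp_add]; congr 1; ring
  have := Real.exp_pos u
  have := Real.exp_pos v
  nlinarith

theorem qd_diff {s : ℝ} (hs : 0 < s) (a b y : ℝ) (hab : |a - b| ≤ 1) :
    |qd s (y - a) - qd s (y - b)| ≤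
      s * |a - b| * ((|y - a| + 1) * qd s (y - a) + (|y - b| + 1) * qd s (y - b)) := by
  have hc : 0 ≤ Real.sqrt s * (Real.sqrt (2 * Real.pi))⁻¹ := by positivity
  have h := exp_diff (-(s * (y-a)^2)/2) (-(s * (y-b)^2)/2)
  have e : -(s * (y-a)^2)/2 - -(s * (y-b)^2)/2 = s * (a - b) * (((y - a) + (y - b))/2) := by ring
  rw [e, abs_mul, abs_mul, abs_of_pos hs] at h
  have k0 : |((y - a) + (y - b))/2| ≤ (|y - a| + |y - b|)/2 := by
    rw [abs_div, abs_of_pos (two_pos : (0:ℝ) < 2)]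
    have := abs_add_le (y-a) (y-b)
    linarith
  have k1 : |y - a| ≤ |y - b| + |a - b| := by
    have := abs_sub_le y b a
    rw [abs_sub_comm b a] at this; exact this
  have k2 : |y - b| ≤ |y - a| + |a - b| := abs_sub_le y a b
  rw [qd_exp hs, qd_exp hs, ← mul_sub, abs_mul, abs_of_nonneg hc]
  set A := Real.exp (-(s * (y-a)^2)/2)
  set B := Real.exp (-(s * (y-b)^2)/2)
  have hA : 0 < A := Real.exp_pos _
  have hB : 0 < B := Real.exp_pos _
  have k3 : |((y - a) + (y - b))/2| * (A + B) ≤ (|y - a| + 1) * A + (|y-b| + 1) * B := by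
    have l1 : |((y - a) + (y - b))/2| ≤ |y - a| + 1 := by linarith
    have l2 : |((y - a) + (y - b))/2| ≤ |y - b| + 1 := by linarith
    nlinarith [mul_le_mul_of_nonneg_right l1 hA.le, mul_le_mul_of_nonneg_right l2 hB.le]
  have k4 : |A - B| ≤ s * |a - b| * ((|y - a| + 1) * A + (|y-b| + 1) * B) := by
    refine h.trans ?_
    rw [mul_assoc]
    exact mul_le_mul_of_nonneg_left k3 (by positivity)
  have := mul_le_mul_of_nonneg_left k4 hc
  refine this.trans (le_of_eq ?_)
  ring

theorem qd_bdd_int {s : ℝ} (hs : 0 < s) (f : ℝ → ℝ) (hm : Measurable f) (hb : ∀ y, |f y| ≤ 1)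
    (a : ℝ) : Integrable (fun y => f y * qd s (y - a)) :=
  ((qd_int hs).comp_sub_right a).bdd_mul (c := 1) hm.aestronglyMeasurable
    (ae_of_all _ fun z => hb _)

theorem qd_bdd {s : ℝ} (hs : 0 < s) (f : ℝ → ℝ) (hm : Measurable f) (hb : ∀ y, |f y| ≤ 1)
    (a : ℝ) : |∫ y, f y * qd s (y - a)| ≤ 1 := by
  have h1 : ∫ y, qd s (y - a) = 1 := by rw [integral_sub_right_eq_self (qd s) a, qd_one hs]
  rw [← h1]
  refine abs_integral_le_integral_abs.trans ?_
  refine integral_mono (qd_bdd_int hs f hm hb a).abs ((qd_int hs).comp_sub_right a) fun y => ?_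
  simp only [abs_mul, abs_of_nonneg (qd_nonneg _ _)]
  exact mul_le_of_le_one_left (qd_nonneg _ _) (hb y)

theorem qd_smooth {s : ℝ} (hs : 0 < s) : ∃ C : ℝ, 0 ≤ C ∧ ∀ f : ℝ → ℝ, Measurable f →
    (∀ y, |f y| ≤ 1) → ∀ a b, |(∫ y, f y * qd s (y - a)) - ∫ y, f y * qd s (y - b)|
      ≤ C * |a - b| := by
  have hI : Integrable (fun y => (|y| + 1) * qd s y) :=
    ((qd_mom_int hs).add (qd_int hs)).congr (ae_of_all _ fun y => by simp; ring)
  set D := ∫ y, (|y| + 1) * qd s y with hD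
  have hD0 : 0 ≤ D := integral_nonneg fun y => mul_nonneg (by positivity) (qd_nonneg _ _)
  refine ⟨s * (2 * D) + 2, by positivity, fun f hm hb a b => ?_⟩
  by_cases hab : |a - b| ≤ 1
  · rw [← integral_sub (qd_bdd_int hs f hm hb a) (qd_bdd_int hs f hm hb b)]
    have Ia := hI.comp_sub_right a
    have Ib := hI.comp_sub_right b
    have step : |∫ y, f y * qd s (y - a) - f y * qd s (y - b)| ≤
        ∫ y, s * |a - b| * ((|y - a| + 1) * qd s (y - a) + (|y - b| + 1) * qd s (y - b)) := by
      refine abs_integral_le_integral_abs.trans ?_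
      refine integral_mono ((qd_bdd_int hs f hm hb a).sub (qd_bdd_int hs f hm hb b)).abs
        ((Ia.add Ib).const_mul _) fun y => ?_
      have := qd_diff hs a b y hab
      simp only [← mul_sub, abs_mul]
      exact (mul_le_of_le_one_left (abs_nonneg _) (hb y)).trans this
    refine step.trans ?_
    rw [integral_const_mul, integral_add Ia Ib,
      integral_sub_right_eq_self (fun y => (|y| + 1) * qd s y) a,
      integral_sub_right_eq_self (fun y => (|y| + 1) * qd s y) b]
    have := abs_nonneg (a - b)
    rw [← hD]
    nlinarith
  · have h1 := abs_le.1 (qd_bdd hs f hm hb a)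
    have h2 := abs_le.1 (qd_bdd hs f hm hb b)
    have : |(∫ y, f y * qd s (y - a)) - ∫ y, f y * qd s (y - b)| ≤ 2 :=
      abs_le.2 ⟨by linarith, by linarith⟩
    push Not at hab
    have : 0 ≤ s * (2 * D) := by positivity
    nlinarith

theorem qd_lip {s : ℝ} (hs : 0 < s) (f : ℝ → ℝ) (hm : Measurable f) (hb : ∀ y, |f y| ≤ 1)
    (K : ℝ) (hK : ∀ x y, |f x - f y| ≤ K * |x - y|) (a b : ℝ) :
    |(∫ y, f y * qd s (y - a)) - ∫ y, f y * qd s (y - b)| ≤ K * |a - b| := by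
  have e : ∀ a, ∫ y, f y * qd s (y - a) = ∫ y, f (y + a) * qd s y := by
    intro a
    rw [← integral_add_right_eq_self (fun y => f y * qd s (y - a)) a]
    simp
  have i : ∀ a, Integrable (fun y => f (y + a) * qd s y) := fun a =>
    (qd_int hs).bdd_mul (c := 1) (hm.comp (by fun_prop)).aestronglyMeasurable
      (ae_of_all _ fun z => hb _)
  rw [e, e, ← integral_sub (i a) (i b)]
  refine abs_integral_le_integral_abs.trans ?_
  have h2 : ∫ y, (K * |a - b|) * qd s y = K * |a - b| := by
    rw [integral_const_mul, qd_one hs, mul_one]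
  rw [← h2]
  refine integral_mono ((i a).sub (i b)).abs ((qd_int hs).const_mul _) fun y => ?_
  simp only [← sub_mul, abs_mul, abs_of_nonneg (qd_nonneg _ _)]
  have := hK (y + a) (y + b)
  simp only [add_sub_add_left_eq_sub] at this
  exact mul_le_mul_of_nonneg_right this (qd_nonneg _ _)


/-- Markov transition densities -/
structure MK (k : ℝ → ℝ → ℝ) : Prop where
  meas : Measurable (Function.uncurry k)
  nonneg : ∀ x y, 0 ≤ k x y
  int : ∀ x, Integrable (k x)
  one : ∀ x, ∫ y, k x y = 1

def Pop (k : ℝ → ℝ → ℝ) (f : ℝ → ℝ) (x : ℝ) : ℝ := ∫ y, f y * k x y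

theorem MK.bint {k : ℝ → ℝ → ℝ} (hk : MK k) {f : ℝ → ℝ} (hm : Measurable f) (hb : ∀ y, |f y| ≤ 1)
    (x : ℝ) : Integrable (fun y => f y * k x y) :=
  (hk.int x).bdd_mul (c := 1) hm.aestronglyMeasurable (ae_of_all _ fun _ => hb _)

theorem MK.pop_meas {k : ℝ → ℝ → ℝ} (hk : MK k) {f : ℝ → ℝ} (hm : Measurable f) :
    Measurable (Pop k f) := by
  have : StronglyMeasurable (Function.uncurry fun x y => f y * k x y) :=
    ((hm.comp measurable_snd).mul hk.meas).stronglyMeasurable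
  exact this.integral_prod_right.measurable

theorem MK.pop_bdd {k : ℝ → ℝ → ℝ} (hk : MK k) {f : ℝ → ℝ} (hm : Measurable f)
    (hb : ∀ y, |f y| ≤ 1) (x : ℝ) : |Pop k f x| ≤ 1 := by
  rw [← hk.one x]
  refine abs_integral_le_integral_abs.trans ?_
  refine integral_mono (hk.bint hm hb x).abs (hk.int x) fun y => ?_
  simp only [abs_mul, abs_of_nonneg (hk.nonneg _ _)]
  exact mul_le_of_le_one_left (hk.nonneg _ _) (hb y)

theorem MK.mix_int {k : ℝ → ℝ → ℝ} (hk : MK k) {p : ℝ → ℝ} (hp : Integrable p) :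
    Integrable (Function.uncurry fun z y => p z * k z y) (volume.prod volume) := by
  rw [integrable_prod_iff]
  · refine ⟨ae_of_all _ fun z => ?_, ?_⟩
    · simpa [Function.uncurry] using (hk.int z).const_mul (p z)
    · refine hp.abs.congr (ae_of_all _ fun z => ?_)
      simp only [Function.uncurry, Real.norm_eq_abs, abs_mul, abs_of_nonneg (hk.nonneg _ _)]
      rw [integral_const_mul, hk.one, mul_one]
  · exact (hp.1.comp_fst).mul hk.meas.aestronglyMeasurable

theorem MK.mix_int' {k : ℝ → ℝ → ℝ} (hk : MK k) {p : ℝ → ℝ} (hp : Integrable p) :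
    Integrable (fun y => ∫ z, p z * k z y) :=
  (hk.mix_int hp).integral_prod_right

theorem MK.mix {k : ℝ → ℝ → ℝ} (hk : MK k) {p : ℝ → ℝ} (hp : Integrable p)
    {f : ℝ → ℝ} (hm : Measurable f) (hb : ∀ y, |f y| ≤ 1) :
    ∫ y, f y * ∫ z, p z * k z y = ∫ z, p z * Pop k f z := by
  have hI : Integrable (Function.uncurry fun z y => f y * (p z * k z y)) (volume.prod volume) :=
    (hk.mix_int hp).bdd_mul (c := 1) (hm.comp measurable_snd).aestronglyMeasurable
      (ae_of_all _ fun _ => hb _)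
  have := integral_integral_swap hI
  simp_rw [← integral_const_mul]
  rw [← this]
  congr 1; ext z
  unfold Pop
  rw [← integral_const_mul]
  congr 1; ext y; ring

theorem MK.kIter {k : ℝ → ℝ → ℝ} (hk : MK k) (m : ℕ) : MK (kIter k m) ∧
    ∀ f : ℝ → ℝ, Measurable f → (∀ y, |f y| ≤ 1) → Pop (_root_.kIter k m) f = (Pop k)^[m+1] f := by
  induction m with
  | zero => exact ⟨hk, fun f _ _ => rfl⟩
  | succ m ih =>
    obtain ⟨ih, ihP⟩ := ih
    have key : ∀ f : ℝ → ℝ, Measurable f → (∀ y, |f y| ≤ 1) →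
        Pop (_root_.kIter k (m+1)) f = Pop (_root_.kIter k m) (Pop k f) := by
      intro f hm hb
      ext x
      have := hk.mix (ih.int x) hm hb
      simp only [Pop, _root_.kIter] at this ⊢
      rw [this]
      congr 1; ext z; ring
    refine ⟨⟨?_, ?_, ?_, ?_⟩, ?_⟩
    · have h1 : Measurable fun q : (ℝ × ℝ) × ℝ => _root_.kIter k m q.1.1 q.2 :=
        ih.meas.comp ((measurable_fst.comp measurable_fst).prodMk measurable_snd)
      have h2 : Measurable fun q : (ℝ × ℝ) × ℝ => k q.2 q.1.2 :=
        hk.meas.comp (measurable_snd.prodMk (measurable_snd.comp measurable_fst))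
      have h3 : StronglyMeasurable (Function.uncurry fun (q : ℝ × ℝ) (z : ℝ) =>
        _root_.kIter k m q.1 z * k z q.2) := (h1.mul h2).stronglyMeasurable
      exact h3.integral_prod_right.measurable
    · intro x y
      exact integral_nonneg fun z => mul_nonneg (ih.nonneg _ _) (hk.nonneg _ _)
    · intro x
      exact hk.mix_int' (ih.int x)
    · intro x
      have h := congrFun (key (fun _ => 1) measurable_const (by simp)) x
      have h2 : Pop k (fun _ => 1) = fun _ => 1 := by
        ext x; simp [Pop, hk.one]
      rw [h2] at h
      simpa [Pop, ih.one] using h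
    · intro f hm hb
      rw [key f hm hb, ihP _ (hk.pop_meas hm) (hk.pop_bdd hm hb)]
      rfl

theorem exists_sign {g : ℝ → ℝ} (hg : Integrable g) : ∃ f : ℝ → ℝ, Measurable f ∧
    (∀ y, |f y| ≤ 1) ∧ ∫ y, |g y| = ∫ y, f y * g y := by
  have hm := hg.1.stronglyMeasurable_mk.measurable
  refine ⟨fun y => if 0 ≤ hg.1.mk g y then 1 else -1, ?_, ?_, ?_⟩
  · exact Measurable.ite (measurableSet_le measurable_const hm) measurable_const measurable_const
  · intro y; dsimp only; split_ifs <;> simp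
  · apply integral_congr_ae
    filter_upwards [hg.1.ae_eq_mk] with y hy
    rw [← hy]
    split_ifs with h
    · rw [abs_of_nonneg h, one_mul]
    · rw [abs_of_neg (not_le.1 h)]; ring

structure Setup (k : ℝ → ℝ → ℝ) (pi : ℝ → ℝ) (C γ : ℝ) : Prop where
  mker : MK k
  C0 : 0 ≤ C
  γ0 : 0 < γ
  sm : ∀ f : ℝ → ℝ, Measurable f → (∀ y, |f y| ≤ 1) → ∀ x y, |Pop k f x - Pop k f y| ≤ C * |x - y|
  lip : ∀ f : ℝ → ℝ, Measurable f → (∀ y, |f y| ≤ 1) → ∀ K, 0 ≤ K →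
    (∀ x y, |f x - f y| ≤ K * |x - y|) → ∀ x y, |Pop k f x - Pop k f y| ≤ γ * K * |x - y|
  pint : Integrable pi
  ppos : ∀ y, 0 < pi y
  pone : ∫ y, pi y = 1
  pmom : Integrable (fun y => y ^ 2 * pi y)
  stat : ∀ y, ∫ x, pi x * k x y = pi y

section
variable {k : ℝ → ℝ → ℝ} {pi : ℝ → ℝ} {C γ : ℝ}

theorem Setup.pmom1 (h : Setup k pi C γ) : Integrable (fun y => |y| * pi y) := by
  refine (h.pint.add h.pmom).mono' ?_ (ae_of_all _ fun y => ?_)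
  · exact (continuous_abs.aestronglyMeasurable).mul h.pint.1
  · have h1 := h.ppos y
    rw [Real.norm_eq_abs, abs_mul, abs_abs, abs_of_pos h1]
    simp only [Pi.add_apply]
    have : |y| ≤ 1 + y^2 := by
      rw [← sq_abs y]; nlinarith [sq_nonneg (|y| - 1)]
    nlinarith

theorem Setup.iter (h : Setup k pi C γ) {f : ℝ → ℝ} (hm : Measurable f) (hb : ∀ y, |f y| ≤ 1)
    (m : ℕ) : Measurable ((Pop k)^[m+1] f) ∧ (∀ y, |(Pop k)^[m+1] f y| ≤ 1) ∧
    (∀ x y, |(Pop k)^[m+1] f x - (Pop k)^[m+1] f y| ≤ C * γ ^ m * |x - y|) ∧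
    ∫ x, pi x * (Pop k)^[m+1] f x = ∫ x, f x * pi x := by
  have hst : ∀ f : ℝ → ℝ, Measurable f → (∀ y, |f y| ≤ 1) →
      ∫ x, pi x * Pop k f x = ∫ x, f x * pi x := by
    intro f hm hb
    rw [← h.mker.mix h.pint hm hb]
    simp_rw [h.stat]
  induction m with
  | zero =>
    refine ⟨h.mker.pop_meas hm, h.mker.pop_bdd hm hb, ?_, hst f hm hb⟩
    simpa using h.sm f hm hb
  | succ m ih =>
    obtain ⟨i1, i2, i3, i4⟩ := ih
    simp only [Function.iterate_succ_apply' (Pop k) (m+1)]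
    refine ⟨h.mker.pop_meas i1, h.mker.pop_bdd i1 i2, ?_, ?_⟩
    · intro x y
      have hg := h.γ0
      have hc := h.C0
      have := h.lip _ i1 i2 (C * γ^m) (by positivity) i3 x y
      refine this.trans (le_of_eq ?_)
      ring
    · rw [hst _ i1 i2, ← i4]
      congr 1; ext x; ring

theorem Setup.dev (h : Setup k pi C γ) {f : ℝ → ℝ} (hm : Measurable f) (hb : ∀ y, |f y| ≤ 1)
    (m : ℕ) (x : ℝ) : |(Pop k)^[m+1] f x - ∫ y, f y * pi y| ≤
      C * γ ^ m * (|x| + ∫ y, |y| * pi y) := by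
  obtain ⟨i1, i2, i3, i4⟩ := h.iter hm hb m
  set F := (Pop k)^[m+1] f
  have hF : Integrable (fun y => pi y * F y) := by
    refine (h.pint.bdd_mul (c := 1) i1.aestronglyMeasurable (ae_of_all _ fun _ => i2 _)).congr
      (ae_of_all _ fun y => mul_comm _ _)
  have e : F x - ∫ y, f y * pi y = ∫ y, (F x * pi y - pi y * F y) := by
    rw [integral_sub (h.pint.const_mul _) hF, integral_const_mul, h.pone, i4, mul_one]
  have hg := h.γ0
  have hc := h.C0
  have e2 : C * γ ^ m * (|x| + ∫ y, |y| * pi y) =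
      ∫ y, C * γ ^ m * (|x| * pi y + |y| * pi y) := by
    rw [integral_const_mul, integral_add (h.pint.const_mul _) h.pmom1, integral_const_mul, h.pone,
      mul_one]
  rw [e, e2]
  refine abs_integral_le_integral_abs.trans ?_
  refine integral_mono ((h.pint.const_mul _).sub hF).abs
    (((h.pint.const_mul _).add h.pmom1).const_mul _) fun y => ?_
  have hp := h.ppos y
  dsimp only
  rw [show F x * pi y - pi y * F y = (F x - F y) * pi y by ring, abs_mul, abs_of_pos hp,
    ← add_mul, ← mul_assoc]
  refine mul_le_mul_of_nonneg_right ((i3 x y).trans ?_) hp.le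
  exact mul_le_mul_of_nonneg_left (abs_sub _ _) (by positivity)

theorem Setup.star (h : Setup k pi C γ) (hγ : γ ≤ 1) : rhoStar1 k pi ≤ γ := by
  have hg := h.γ0
  have hc := h.C0
  apply csInf_le ⟨0, fun r hr => hr.1.1⟩
  have hA : 0 ≤ ∫ y, |y| * pi y := integral_nonneg fun y => mul_nonneg (abs_nonneg _) (h.ppos y).le
  refine ⟨⟨hg.le, hγ⟩, fun x => C / γ * (|x| + ∫ y, |y| * pi y), fun x => by positivity, ?_⟩
  intro x m
  obtain ⟨hk, hP⟩ := h.mker.kIter m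
  have hI : Integrable (fun y => kIter k m x y - pi y) := (hk.int x).sub h.pint
  obtain ⟨f, hm, hb, he⟩ := exists_sign hI
  rw [he]
  have hfp : Integrable (fun y => f y * pi y) :=
    h.pint.bdd_mul (c := 1) hm.aestronglyMeasurable (ae_of_all _ fun _ => hb _)
  have e : ∫ y, f y * (kIter k m x y - pi y) = (Pop k)^[m+1] f x - ∫ y, f y * pi y := by
    simp_rw [mul_sub]
    rw [integral_sub (hk.bint hm hb x) hfp, ← hP f hm hb]
    rfl
  rw [e]
  refine (le_abs_self _).trans ((h.dev hm hb m x).trans (le_of_eq ?_))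
  rw [pow_succ]
  field_simp

theorem Setup.ss (h : Setup k pi C γ) (hγ : γ ≤ 1) : rhoSS1 k pi ≤ γ := by
  have hg := h.γ0
  have hc := h.C0
  apply csInf_le ⟨0, fun r hr => hr.1.1⟩
  refine ⟨⟨hg.le, hγ⟩, fun ν hν h1 h2 => ?_⟩
  have hν1 : Integrable ν := by
    by_contra hn
    rw [integral_undef hn] at h1
    norm_num at h1
  have hmom : Integrable (fun x => |x| * ν x) := by
    refine (h.pmom.add h2).mono' ?_ (ae_of_all _ fun y => ?_)
    · exact (continuous_abs.aestronglyMeasurable).mul hν1.1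
    · have hp := h.ppos y
      rw [Real.norm_eq_abs, abs_mul, abs_abs, abs_of_nonneg (hν y)]
      simp only [Pi.add_apply]
      rw [← sq_abs y]
      have e : |y| ^ 2 * pi y + ν y ^ 2 / pi y - |y| * ν y =
        ((|y| * pi y - ν y)^2 + |y| * pi y * ν y) / pi y := by
        field_simp; ring
      have : 0 ≤ ((|y| * pi y - ν y)^2 + |y| * pi y * ν y) / pi y := by
        have := hν y
        positivity
      linarith
  set A := ∫ y, |y| * pi y with hA
  refine ⟨C / γ * ((∫ x, |x| * ν x) + A), fun m => ?_⟩
  obtain ⟨hk, hP⟩ := h.mker.kIter m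
  simp_rw [mul_comm (kIter k m _ _) (ν _)]
  have hI : Integrable (fun y => (∫ x, ν x * kIter k m x y) - pi y) :=
    (hk.mix_int' hν1).sub h.pint
  obtain ⟨f, hm, hb, he⟩ := exists_sign hI
  rw [he]
  have hfp : Integrable (fun y => f y * pi y) :=
    h.pint.bdd_mul (c := 1) hm.aestronglyMeasurable (ae_of_all _ fun _ => hb _)
  have hfm : Integrable (fun y => f y * ∫ x, ν x * kIter k m x y) :=
    (hk.mix_int' hν1).bdd_mul (c := 1) hm.aestronglyMeasurable (ae_of_all _ fun _ => hb _)
  obtain ⟨i1, i2, i3, i4⟩ := h.iter hm hb m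
  have hνF : Integrable (fun x => ν x * (Pop k)^[m+1] f x) :=
    (hν1.bdd_mul (c := 1) i1.aestronglyMeasurable (ae_of_all _ fun _ => i2 _)).congr
      (ae_of_all _ fun y => mul_comm _ _)
  have e : ∫ y, f y * ((∫ x, ν x * kIter k m x y) - pi y) =
      ∫ x, (ν x * (Pop k)^[m+1] f x - ν x * ∫ y, f y * pi y) := by
    simp_rw [mul_sub]
    rw [integral_sub hfm hfp, hk.mix hν1 hm hb, hP f hm hb,
      integral_sub hνF (hν1.mul_const _), integral_mul_const, h1, one_mul]
  have e2 : C / γ * ((∫ x, |x| * ν x) + A) * γ ^ (m+1) =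
      ∫ x, C * γ ^ m * (|x| * ν x + A * ν x) := by
    rw [integral_const_mul, integral_add hmom (hν1.const_mul _), integral_const_mul, h1, pow_succ]
    field_simp
  rw [e, e2]
  refine integral_mono (hνF.sub (hν1.mul_const _)) ((hmom.add (hν1.const_mul _)).const_mul _)
    fun x => ?_
  dsimp only
  rw [← mul_sub, ← add_mul, ← mul_assoc, mul_comm (ν x)]
  exact mul_le_mul_of_nonneg_right ((le_abs_self _).trans (h.dev hm hb m x)) (hν x)

end


section AC
variable {Q : ℝ} {n : ℕ} (Yb : Fin n → Bool)

theorem kAC1_eq (Q : ℝ) (x y : ℝ) : kAC1 Q n Yb x y =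
    ∫ z : Fin n → ℝ, qd (n + Q) (y - (∑ i, z i) / (n + Q)) * Wd Yb x z := rfl

theorem s_pos (hQ : 0 < Q) : 0 < (n : ℝ) + Q := by positivity

theorem AC_joint_int (hQ : 0 < Q) (x : ℝ) : Integrable
    (Function.uncurry fun (z : Fin n → ℝ) (y : ℝ) =>
      qd (n + Q) (y - (∑ i, z i) / (n + Q)) * Wd Yb x z) (volume.prod volume) := by
  have hs := s_pos (n := n) hQ
  rw [integrable_prod_iff]
  · refine ⟨ae_of_all _ fun z => ?_, ?_⟩
    · simp only [Function.uncurry]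
      exact ((qd_int hs).comp_sub_right _).mul_const _
    · refine (Wd_int Yb x).congr (ae_of_all _ fun z => ?_)
      simp only [Function.uncurry, Real.norm_eq_abs, abs_mul, abs_of_nonneg (qd_nonneg _ _),
        abs_of_nonneg (Wd_nonneg Yb _ _)]
      rw [integral_mul_const, integral_sub_right_eq_self (qd ((n:ℝ)+Q)), qd_one hs, one_mul]
  · have h1 := (qd_cont ((n:ℝ)+Q)).measurable
    have h2 : Measurable fun p : (Fin n → ℝ) × ℝ => Wd Yb x p.1 :=
      (Wd_meas Yb).comp (measurable_const.prodMk measurable_fst)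
    refine Measurable.aestronglyMeasurable ?_
    simp only [Function.uncurry_def]
    refine Measurable.mul (h1.comp ?_) h2
    fun_prop

def hsm (s : ℝ) (f : ℝ → ℝ) (t : ℝ) : ℝ := ∫ y, f y * qd s (y - t / s)

theorem hsm_meas (s : ℝ) {f : ℝ → ℝ} (hm : Measurable f) : Measurable (hsm s f) := by
  have h1 := (qd_cont s).measurable
  have : StronglyMeasurable (Function.uncurry fun t y => f y * qd s (y - t / s)) := by
    refine Measurable.stronglyMeasurable ?_
    simp only [Function.uncurry_def]
    fun_prop
  exact this.integral_prod_right.measurable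

theorem AC_pop (hQ : 0 < Q) {f : ℝ → ℝ} (hm : Measurable f) (hb : ∀ y, |f y| ≤ 1) (x : ℝ) :
    Pop (kAC1 Q n Yb) f x = ∫ z : Fin n → ℝ, hsm (n + Q) f (∑ i, z i) * Wd Yb x z := by
  have hI : Integrable (Function.uncurry fun (z : Fin n → ℝ) (y : ℝ) =>
      f y * (qd (n + Q) (y - (∑ i, z i) / (n + Q)) * Wd Yb x z)) (volume.prod volume) :=
    (AC_joint_int Yb hQ x).bdd_mul (c := 1) (hm.comp measurable_snd).aestronglyMeasurable
      (ae_of_all _ fun _ => hb _)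
  have := integral_integral_swap hI
  unfold Pop
  simp_rw [kAC1_eq, ← integral_const_mul]
  rw [← this]
  congr 1; ext z
  unfold hsm
  rw [← integral_mul_const]
  congr 1; ext y; ring

theorem AC_MK (hQ : 0 < Q) : MK (kAC1 Q n Yb) := by
  have hs := s_pos (n := n) hQ
  refine ⟨?_, ?_, ?_, ?_⟩
  · have h1 := (qd_cont ((n:ℝ)+Q)).measurable
    have h2 : Measurable fun p : (ℝ × ℝ) × (Fin n → ℝ) => Wd Yb p.1.1 p.2 :=
      (Wd_meas Yb).comp ((measurable_fst.comp measurable_fst).prodMk measurable_snd)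
    have h3 : StronglyMeasurable (Function.uncurry fun (p : ℝ × ℝ) (z : Fin n → ℝ) =>
        qd (n + Q) (p.2 - (∑ i, z i) / (n + Q)) * Wd Yb p.1 z) := by
      refine Measurable.stronglyMeasurable ?_
      simp only [Function.uncurry_def]
      refine Measurable.mul (h1.comp ?_) h2
      fun_prop
    exact h3.integral_prod_right.measurable
  · intro x y
    rw [kAC1_eq]
    exact integral_nonneg fun z => mul_nonneg (qd_nonneg _ _) (Wd_nonneg _ _ _)
  · intro x
    exact (AC_joint_int Yb hQ x).integral_prod_right
  · intro x
    have := AC_pop Yb hQ (f := fun _ => 1) measurable_const (by simp) x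
    have h2 : ∀ t, hsm (n + Q) (fun _ => 1) t = 1 := by
      intro t
      simp only [hsm, one_mul]
      rw [integral_sub_right_eq_self (qd ((n:ℝ)+Q)), qd_one hs]
    simp only [h2, one_mul, Wd_one, Pop] at this
    exact this

/-- unnormalised posterior -/
def pnum (Q : ℝ) (x : ℝ) : ℝ :=
  (∏ i, if Yb i then nPhi x else 1 - nPhi x) * Real.exp (-(Q * x ^ 2) / 2)

theorem post1_eq (x : ℝ) : post1 Q n Yb x = pnum Yb Q x / ∫ y, pnum Yb Q y := rfl

theorem pnum_pos (x : ℝ) : 0 < pnum Yb Q x :=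
  mul_pos (Finset.prod_pos fun i _ => tnN_pos x (Yb i)) (Real.exp_pos _)

theorem pnum_le (x : ℝ) : pnum Yb Q x ≤ Real.exp (-(Q * x ^ 2) / 2) := by
  refine mul_le_of_le_one_left (Real.exp_pos _).le ?_
  refine Finset.prod_le_one (fun i _ => (tnN_pos x (Yb i)).le) fun i _ => ?_
  have := nPhi_pos x
  have := nPhi_lt_one x
  split_ifs <;> linarith

theorem pnum_cont : Continuous (pnum Yb Q) := by
  have := nPhi_cont
  unfold pnum
  refine Continuous.mul (continuous_finsetProd _ fun i _ => ?_) (by fun_prop)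
  split_ifs <;> fun_prop

theorem pnum_int (hQ : 0 < Q) : Integrable (pnum Yb Q) := by
  have h := integrable_exp_neg_mul_sq (b := Q/2) (by positivity)
  refine h.mono' (pnum_cont Yb).aestronglyMeasurable (ae_of_all _ fun x => ?_)
  rw [Real.norm_eq_abs, abs_of_pos (pnum_pos Yb x)]
  refine (pnum_le Yb x).trans (le_of_eq ?_)
  congr 1; ring

theorem pnum_mom (hQ : 0 < Q) : Integrable (fun x => x ^ 2 * pnum Yb Q x) := by
  have h := integrable_rpow_mul_exp_neg_mul_sq (b := Q/2) (by positivity) (s := 2) (by norm_num)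
  refine h.mono' ((continuous_pow 2).mul (pnum_cont Yb)).aestronglyMeasurable
    (ae_of_all _ fun x => ?_)
  rw [Real.norm_eq_abs, abs_mul, abs_of_pos (pnum_pos Yb x), abs_of_nonneg (sq_nonneg x)]
  have e : x ^ (2:ℝ) = x ^ 2 := by norm_cast
  rw [e]
  refine mul_le_mul_of_nonneg_left ((pnum_le Yb x).trans (le_of_eq ?_)) (sq_nonneg x)
  congr 1; ring

theorem pnum_Z (hQ : 0 < Q) : 0 < ∫ x, pnum Yb Q x := by
  rw [integral_pos_iff_support_of_nonneg (fun x => (pnum_pos Yb x).le) (pnum_int Yb hQ)]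
  have : Function.support (pnum Yb Q) = Set.univ := by
    ext t; simp [(pnum_pos Yb t).ne']
  rw [this]; simp

theorem pnum_tnA (x : ℝ) : pnum Yb Q x * ∏ i, tnA x (Yb i) =
    Real.exp (-(((n:ℝ) + Q) * x ^ 2) / 2) := by
  have h : (∏ i, if Yb i then nPhi x else 1 - nPhi x) * ∏ i, tnA x (Yb i) =
      Real.exp (-((n:ℝ) * x^2)/2) := by
    rw [← Finset.prod_mul_distrib]
    have : ∀ i, (if Yb i then nPhi x else 1 - nPhi x) * tnA x (Yb i) = Real.exp (-(x^2)/2) := by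
      intro i
      have := (tnN_pos x (Yb i)).ne'
      unfold tnA
      field_simp
    simp_rw [this]
    rw [Finset.prod_const, ← Real.exp_nat_mul]
    simp only [Finset.card_univ, Fintype.card_fin]
    congr 1; ring
  unfold pnum
  rw [mul_right_comm, h, ← Real.exp_add]
  congr 1; ring

theorem balance_pt (hQ : 0 < Q) (x y : ℝ) (z : Fin n → ℝ) :
    pnum Yb Q x * (qd (n + Q) (y - (∑ i, z i) / (n + Q)) * Wd Yb x z) =
    pnum Yb Q y * (qd (n + Q) (x - (∑ i, z i) / (n + Q)) * Wd Yb y z) := by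
  have hs := s_pos (n := n) hQ
  have key : ∀ x y, pnum Yb Q x * (qd (n + Q) (y - (∑ i, z i) / (n + Q)) * Wd Yb x z) =
      (∏ i, tnG (Yb i) (z i)) * (Real.sqrt (n+Q) * (Real.sqrt (2 * Real.pi))⁻¹) *
      Real.exp (-(((n:ℝ) + Q) * (x ^ 2 + y ^ 2)) / 2 + (x + y) * (∑ i, z i)
        - (∑ i, z i)^2 / (2 * (n+Q))) := by
    intro x y
    rw [qd_exp hs, Wd_factor]
    set S := ∑ i, z i
    calc _ = (pnum Yb Q x * ∏ i, tnA x (Yb i)) *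
        Real.exp (-((n + Q) * (y - S / (n + Q)) ^ 2) / 2) * Real.exp (x * S) *
        ((∏ i, tnG (Yb i) (z i)) * (Real.sqrt (n+Q) * (Real.sqrt (2 * Real.pi))⁻¹)) := by ring
      _ = _ := by
        rw [pnum_tnA, ← Real.exp_add, ← Real.exp_add, mul_comm]
        congr 2
        field_simp
        ring
  rw [key, key, add_comm (x^2), add_comm x]

theorem balance (hQ : 0 < Q) (x y : ℝ) :
    post1 Q n Yb x * kAC1 Q n Yb x y = post1 Q n Yb y * kAC1 Q n Yb y x := by
  rw [post1_eq, post1_eq, div_mul_eq_mul_div, div_mul_eq_mul_div]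
  congr 1
  rw [kAC1_eq, kAC1_eq, ← integral_const_mul, ← integral_const_mul]
  congr 1; ext z
  exact balance_pt Yb hQ x y z

theorem AC_lip_gen (hQ : 0 < Q) {γ : ℝ} (hγ : 0 ≤ γ)
    (hbm : ∀ x y, x ≤ y → ∑ i, bmean y (Yb i) - ∑ i, bmean x (Yb i) ≤ γ * n * (y - x))
    {f : ℝ → ℝ} (hm : Measurable f) (hb : ∀ y, |f y| ≤ 1) {K : ℝ} (hK : 0 ≤ K)
    (hl : ∀ a b, |(∫ y, f y * qd (n + Q) (y - a)) - ∫ y, f y * qd (n + Q) (y - b)| ≤ K * |a - b|)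
    (x y : ℝ) : |Pop (kAC1 Q n Yb) f x - Pop (kAC1 Q n Yb) f y| ≤ γ * K * |x - y| := by
  have hs := s_pos (n := n) hQ
  wlog hxy : x ≤ y generalizing x y
  · rw [abs_sub_comm, abs_sub_comm x]
    exact this y x (by linarith)
  rw [abs_sub_comm, abs_sub_comm x, abs_of_nonneg (sub_nonneg.2 hxy), AC_pop Yb hQ hm hb,
    AC_pop Yb hQ hm hb]
  have hK' : ∀ s t, |hsm (n + Q) f s - hsm (n + Q) f t| ≤ (K / (n+Q)) * |s - t| := by
    intro s t
    refine (hl _ _).trans (le_of_eq ?_)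
    rw [← sub_div, abs_div, abs_of_pos hs]
    ring
  refine (Wd_lip Yb (hsm (n+Q) f) (hsm_meas _ hm) (fun t => qd_bdd hs f hm hb _) _ hK' hxy).trans ?_
  refine (mul_le_mul_of_nonneg_left (hbm x y hxy) (by positivity)).trans ?_
  have h1 : (n:ℝ) / (n + Q) ≤ 1 := by
    rw [div_le_one hs]; linarith
  have h2 : 0 ≤ γ * K * (y - x) := mul_nonneg (by positivity) (by linarith)
  calc K / (n+Q) * (γ * n * (y - x)) = (γ * K * (y - x)) * ((n:ℝ) / (n + Q)) := by ring
    _ ≤ _ := mul_le_of_le_one_right h2 h1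

theorem AC_setup (hQ : 0 < Q) {γ : ℝ} (hγ : 0 < γ)
    (hbm : ∀ x y, x ≤ y → ∑ i, bmean y (Yb i) - ∑ i, bmean x (Yb i) ≤ γ * n * (y - x)) :
    ∃ C, Setup (kAC1 Q n Yb) (post1 Q n Yb) C γ := by
  have hs := s_pos (n := n) hQ
  have hZ := pnum_Z Yb hQ
  obtain ⟨C, hC, hCs⟩ := qd_smooth hs
  refine ⟨γ * C, ⟨AC_MK Yb hQ, by positivity, hγ, ?_, ?_, ?_, ?_, ?_, ?_, ?_⟩⟩
  · intro f hm hb x y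
    exact AC_lip_gen Yb hQ hγ.le hbm hm hb hC (hCs f hm hb) x y
  · intro f hm hb K hK hl x y
    exact AC_lip_gen Yb hQ hγ.le hbm hm hb hK (qd_lip hs f hm hb K hl) x y
  · exact (pnum_int Yb hQ).div_const _
  · intro y
    rw [post1_eq]
    exact div_pos (pnum_pos Yb y) hZ
  · simp_rw [post1_eq]
    rw [integral_div, div_self hZ.ne']
  · simp_rw [post1_eq, ← mul_div_assoc]
    exact (pnum_mom Yb hQ).div_const _
  · intro y
    simp_rw [balance Yb hQ _ y]
    rw [integral_const_mul, (AC_MK Yb hQ).one, mul_one]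

theorem bmean_total {γ : ℝ}
    (h1 : ∑ i, (if Yb i then (1/2 : ℝ) else 1) ≤ γ * n)
    (h2 : ∑ i, (if Yb i then (1 : ℝ) else 1/2) ≤ γ * n) (x y : ℝ) (hxy : x ≤ y) :
    ∑ i, bmean y (Yb i) - ∑ i, bmean x (Yb i) ≤ γ * n * (y - x) := by
  have neg : ∀ x y, x ≤ y → y ≤ 0 →
      ∑ i, bmean y (Yb i) - ∑ i, bmean x (Yb i) ≤ γ * n * (y - x) := by
    intro x y h hy
    rw [← Finset.sum_sub_distrib]
    refine (Finset.sum_le_sum fun i _ => bmean_neg_side (Yb i) h hy).trans ?_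
    rw [← Finset.sum_mul]
    exact mul_le_mul_of_nonneg_right h1 (by linarith)
  have pos : ∀ x y, x ≤ y → 0 ≤ x →
      ∑ i, bmean y (Yb i) - ∑ i, bmean x (Yb i) ≤ γ * n * (y - x) := by
    intro x y h hx
    rw [← Finset.sum_sub_distrib]
    refine (Finset.sum_le_sum fun i _ => bmean_pos_side (Yb i) h hx).trans ?_
    rw [← Finset.sum_mul]
    exact mul_le_mul_of_nonneg_right h2 (by linarith)
  rcases le_total y 0 with hy | hy
  · exact neg x y hxy hy
  rcases le_total 0 x with hx | hx
  · exact pos x y hxy hx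
  have a := neg x 0 hx le_rfl
  have b := pos 0 y hy le_rfl
  nlinarith

end AC

theorem phat_mem (Ys : ℕ → Bool) (n : ℕ) : 0 ≤ phat Ys n ∧ phat Ys n ≤ 1 := by
  unfold phat
  constructor
  · refine div_nonneg (Finset.sum_nonneg fun i _ => ?_) (Nat.cast_nonneg n)
    split_ifs <;> norm_num
  · refine div_le_one_of_le₀ ?_ (Nat.cast_nonneg n)
    calc _ ≤ ∑ i ∈ Finset.range n, (1:ℝ) := Finset.sum_le_sum fun i _ => by split_ifs <;> norm_num
      _ = n := by simp

theorem rates_le {Q : ℝ} (hQ : 0 < Q) (Ys : ℕ → Bool) (n : ℕ) (hn : 0 < n) (b : ℝ)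
    (hb1 : b ≤ 1) (hb0 : 0 ≤ b) (h1 : b ≤ phat Ys n) (h2 : phat Ys n ≤ 1 - b) :
    rhoStar1 (kAC1 Q n (fun i => Ys i.1)) (post1 Q n (fun i => Ys i.1)) ≤ 1 - b / 2 ∧
    rhoSS1 (kAC1 Q n (fun i => Ys i.1)) (post1 Q n (fun i => Ys i.1)) ≤ 1 - b / 2 := by
  have hn' : (0:ℝ) < n := by exact_mod_cast hn
  have hN : ∑ i : Fin n, (if Ys i.1 then (1:ℝ) else 0) = phat Ys n * n := by
    unfold phat
    rw [div_mul_cancel₀ _ hn'.ne', Fin.sum_univ_eq_sum_range (fun i => if Ys i then (1:ℝ) else 0)]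
  have e1 : ∑ i : Fin n, (if Ys i.1 then (1/2:ℝ) else 1) = n - phat Ys n * n / 2 := by
    rw [← hN, Finset.sum_div]
    have : (n:ℝ) = ∑ i : Fin n, (1:ℝ) := by simp
    nth_rw 1 [this]
    rw [← Finset.sum_sub_distrib]
    refine Finset.sum_congr rfl fun i _ => ?_
    split_ifs <;> norm_num
  have e2 : ∑ i : Fin n, (if Ys i.1 then (1:ℝ) else 1/2) = n / 2 + phat Ys n * n / 2 := by
    rw [← hN, Finset.sum_div]
    have : (n:ℝ) / 2 = ∑ i : Fin n, (1/2:ℝ) := by simp; ring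
    rw [this, ← Finset.sum_add_distrib]
    refine Finset.sum_congr rfl fun i _ => ?_
    split_ifs <;> norm_num
  obtain ⟨C, hS⟩ := AC_setup (fun i : Fin n => Ys i.1) hQ (γ := 1 - b/2) (by linarith)
    (bmean_total _ (by rw [e1]; nlinarith) (by rw [e2]; nlinarith))
  exact ⟨hS.star (by linarith), hS.ss (by linarith)⟩

/-- in the intercept-only model, if the proportions of successes are
asymptotically bounded away from 0 and 1, then both the geometric and the
L²-geometric convergence rates of Albert and Chib's chains are asymptotically
bounded above by an explicit ρ < 1 built from the Rosenthal bound. -/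
theorem intercept_only_rates_bounded
    (Q : ℝ) (hQ : 0 < Q) (Ys : ℕ → Bool)
    (hlo : 0 < liminf (phat Ys) atTop) (hhi : limsup (phat Ys) atTop < 1)
    (δ : ℝ)
    (hδ : δ ∈ Set.Ioo (0 : ℝ)
      (1 - (1 - (2 / Real.pi) *
        min (liminf (phat Ys) atTop) (1 - limsup (phat Ys) atTop)) ^ 2))
    (lam : ℝ)
    (hlam : lam = (1 - (2 / Real.pi) *
      min (liminf (phat Ys) atTop) (1 - limsup (phat Ys) atTop)) ^ 2 + δ)
    (L : ℝ) (hL : L = 1 + lam)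
    (d : ℝ) (hd : d > 2 * L / (1 - lam))
    (eps : ℝ) (heps : eps = (2 : ℝ) ^ (-(1 : ℝ) / 2) * Real.exp (-d))
    (r : ℝ) (hr : r ∈ Set.Ioo (0 : ℝ) 1)
    (ρ : ℝ)
    (hρdef : ρ = max ((1 - eps) ^ r)
      (((1 + 2 * L + lam * d) / (1 + d)) ^ (1 - r) * (1 + 2 * (lam * d + L)) ^ r))
    (hρ : ρ < 1) :
    limsup (fun n => rhoStar1 (kAC1 Q n (fun i => Ys i.1)) (post1 Q n (fun i => Ys i.1)))
        atTop ≤ ρ ∧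
    limsup (fun n => rhoSS1 (kAC1 Q n (fun i => Ys i.1)) (post1 Q n (fun i => Ys i.1)))
        atTop ≤ ρ := by
  obtain ⟨hδ0, hδ1⟩ := hδ
  set ms := min (liminf (phat Ys) atTop) (1 - limsup (phat Ys) atTop) with hms
  have hms0 : 0 < ms := lt_min hlo (by linarith)
  have hpi := Real.pi_gt_three
  set m := 2 / Real.pi * ms with hm
  have hm0 : 0 < m := by positivity
  have hl1 : lam < 1 := by rw [hlam]; linarith
  have hl0 : 0 < lam := by rw [hlam]; positivity
  have hl2 : 1 - lam < 2 * m := by rw [hlam]; nlinarith [sq_nonneg m]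
  have hd1 : 1 / m < d := by
    refine lt_of_lt_of_le ?_ hd.le
    rw [div_lt_div_iff₀ hm0 (by linarith), hL]
    nlinarith
  have hexp : Real.exp (-d) < m := by
    rw [Real.exp_neg, inv_lt_comm₀ (Real.exp_pos d) hm0]
    have := Real.add_one_le_exp d
    rw [one_div] at hd1
    linarith
  have hr2 : (2 : ℝ) ^ (-(1 : ℝ) / 2) = (Real.sqrt 2)⁻¹ := by
    rw [neg_div, Real.rpow_neg (by norm_num), Real.sqrt_eq_rpow]
  have hsq : (Real.sqrt 2)⁻¹ ≤ 3 / 4 := by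
    rw [inv_le_comm₀ (by positivity) (by norm_num)]
    refine Real.le_sqrt_of_sq_le ?_
    norm_num
  have hsq0 : 0 < (Real.sqrt 2)⁻¹ := by positivity
  have heps0 : 0 < eps := by rw [heps, hr2]; positivity
  have heps1 : 2 * eps < ms := by
    have h1 : eps < 3 / 4 * m := by
      rw [heps, hr2]
      calc (Real.sqrt 2)⁻¹ * Real.exp (-d) < (Real.sqrt 2)⁻¹ * m :=
            mul_lt_mul_of_pos_left hexp hsq0
        _ ≤ _ := mul_le_mul_of_nonneg_right hsq hm0.le
    have h2 : m ≤ 2 / 3 * ms := by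
      rw [hm]
      refine mul_le_mul_of_nonneg_right ?_ hms0.le
      exact div_le_div_of_nonneg_left (by norm_num) (by norm_num) hpi.le
    linarith
  have bdA : IsBoundedUnder (· ≤ ·) atTop (phat Ys) :=
    isBoundedUnder_of ⟨1, fun n => (phat_mem Ys n).2⟩
  have bdB : IsBoundedUnder (· ≥ ·) atTop (phat Ys) :=
    isBoundedUnder_of ⟨0, fun n => (phat_mem Ys n).1⟩
  have ev1 : ∀ᶠ n in atTop, 2 * eps < phat Ys n :=
    eventually_lt_of_lt_liminf (lt_of_lt_of_le heps1 (min_le_left _ _)) bdB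
  have ev2 : ∀ᶠ n in atTop, phat Ys n < 1 - 2 * eps :=
    eventually_lt_of_limsup_lt (by
      have := lt_of_lt_of_le heps1 (min_le_right _ _)
      linarith) bdA
  have heps2 : 2 * eps ≤ 1 := by
    obtain ⟨n, hn⟩ := ev1.exists
    have := (phat_mem Ys n).2
    linarith
  have hρ1 : 1 - eps ≤ ρ := by
    rw [hρdef]
    refine le_trans ?_ (le_max_left _ _)
    have := Real.rpow_le_rpow_of_exponent_ge (x := 1 - eps) (by linarith) (by linarith) hr.2.le
    rwa [Real.rpow_one] at this
  have ev : ∀ᶠ n in atTop,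
      rhoStar1 (kAC1 Q n (fun i => Ys i.1)) (post1 Q n (fun i => Ys i.1)) ≤ ρ ∧
      rhoSS1 (kAC1 Q n (fun i => Ys i.1)) (post1 Q n (fun i => Ys i.1)) ≤ ρ := by
    filter_upwards [ev1, ev2, eventually_gt_atTop 0] with n h1 h2 h3
    obtain ⟨a, b⟩ := rates_le hQ Ys n h3 (2 * eps) heps2 (by linarith) h1.le h2.le
    constructor <;> linarith
  constructor
  · refine limsup_le_of_le ?_ (ev.mono fun n h => h.1)
    refine IsBoundedUnder.isCoboundedUnder_le (isBoundedUnder_of ⟨0, fun n => ?_⟩)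
    exact Real.sInf_nonneg fun r hr => hr.1.1
  · refine limsup_le_of_le ?_ (ev.mono fun n h => h.2)
    refine IsBoundedUnder.isCoboundedUnder_le (isBoundedUnder_of ⟨0, fun n => ?_⟩)
    exact Real.sInf_nonneg fun r hr => hr.1.1
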